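/- There exists a constant C > 0 such that for every finite word i over I, all a₁, b₁, b₂ ∈ [0,1] with a₁ ≠ b₁, one has |g_i(b₁, b₂) − g_i(a₁, b₂)| ≤ C · |f_i(b₁) − f_i(a₁)|, where (f_i(·), g_i(·,·)) denote the coordinate functions of the composition S_i. -/

import Mathlib

open MeasureTheory Filter Set

noncomputable section

namespace FFL

/-- The unit square `[0,1]² ⊆ ℝ²`. -/
def sq : Set (ℝ × ℝ) := Set.Icc (0:ℝ) 1 ×ˢ Set.Icc (0:ℝ) 1

/-- The Euclidean metric on `ℝ²`. -/
def dE (a b : ℝ × ℝ) : ℝ := Real.sqrt ((a.1 - b.1) ^ 2 + (a.2 - b.2) ^ 2)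

/-- Squared Frobenius norm of a 2×2 real matrix. -/
def frobSq (A : Matrix (Fin 2) (Fin 2) ℝ) : ℝ := ∑ i, ∑ j, (A i j) ^ 2

/-- The larger singular value `α₁` of a 2×2 real matrix, i.e. the larger positive square
root of the eigenvalues of `AᵀA`, via the standard closed formula. -/
def sv1 (A : Matrix (Fin 2) (Fin 2) ℝ) : ℝ :=
  Real.sqrt ((frobSq A + Real.sqrt ((frobSq A) ^ 2 - 4 * (A.det) ^ 2)) / 2)

/-- The smaller singular value `α₂` of a 2×2 real matrix. -/
def sv2 (A : Matrix (Fin 2) (Fin 2) ℝ) : ℝ :=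
  Real.sqrt ((frobSq A - Real.sqrt ((frobSq A) ^ 2 - 4 * (A.det) ^ 2)) / 2)

/-- The nonlinear, non-conformal iterated function systems of Falconer, Fraser and Lee:
maps `S i (a₁,a₂) = (f i a₁, g i (a₁,a₂))` on the unit square, where `f i`, `g i` are
`C^{1+α}` contractions (with partial derivatives `fx`, `gx`, `gy`) satisfying the
domination condition. -/
structure System (I : Type) [Fintype I] where
  f : I → ℝ → ℝ
  g : I → ℝ × ℝ → ℝ
  fx : I → ℝ → ℝ
  gx : I → ℝ × ℝ → ℝ
  gy : I → ℝ × ℝ → ℝ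
  /-- the index set has at least two elements -/
  card2 : 2 ≤ Fintype.card I
  /-- each `S i` maps the unit square into itself -/
  mapsTo : ∀ i, Set.MapsTo (fun a => (f i a.1, g i a)) sq sq
  /-- `fx i` is the derivative of `f i` on `[0,1]` -/
  hasDeriv_f : ∀ i, ∀ x ∈ Set.Icc (0:ℝ) 1,
    HasDerivWithinAt (f i) (fx i x) (Set.Icc (0:ℝ) 1) x
  /-- `(gx i, gy i)` is the (total) derivative of `g i` on the unit square -/
  hasDeriv_g : ∀ i, ∀ a ∈ sq, HasFDerivWithinAt (g i)
      (gx i a • ContinuousLinearMap.fst ℝ ℝ ℝ + gy i a • ContinuousLinearMap.snd ℝ ℝ ℝ) sq a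
  /-- the derivatives are `α`-Hölder for some `α > 0`, i.e. `f i`, `g i` are `C^{1+α}` -/
  holder : ∃ α > (0:ℝ), ∃ H > (0:ℝ), ∀ i,
      (∀ x ∈ Set.Icc (0:ℝ) 1, ∀ y ∈ Set.Icc (0:ℝ) 1, |fx i x - fx i y| ≤ H * |x - y| ^ α) ∧
      (∀ a ∈ sq, ∀ b ∈ sq, |gx i a - gx i b| ≤ H * dE a b ^ α) ∧
      (∀ a ∈ sq, ∀ b ∈ sq, |gy i a - gy i b| ≤ H * dE a b ^ α)
  /-- the maps `f i`, `g i` (hence `S i`) are uniform contractions -/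
  contracting : ∃ c, 0 ≤ c ∧ c < 1 ∧ ∀ i,
      (∀ x ∈ Set.Icc (0:ℝ) 1, ∀ y ∈ Set.Icc (0:ℝ) 1, |f i x - f i y| ≤ c * |x - y|) ∧
      (∀ a ∈ sq, ∀ b ∈ sq, |g i a - g i b| ≤ c * dE a b) ∧
      (∀ a ∈ sq, ∀ b ∈ sq, dE (f i a.1, g i a) (f i b.1, g i b) ≤ c * dE a b)
  /-- the domination condition:
  `inf |f_{i,x}| > sup |g_{i,y}| ≥ inf |g_{i,y}| ≥ d > 0` -/
  domination : ∃ d > (0:ℝ), ∀ i,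
      d ≤ sInf ((fun a => |gy i a|) '' sq) ∧
      sSup ((fun a => |gy i a|) '' sq) < sInf ((fun x => |fx i x|) '' Set.Icc (0:ℝ) 1)

variable {I : Type} [Fintype I]

/-- The map `S i`. -/
def S (T : System I) (i : I) (a : ℝ × ℝ) : ℝ × ℝ := (T.f i a.1, T.g i a)

/-- The composition `S_w = S_{i₁} ∘ ⋯ ∘ S_{i_n}` along a finite word `w = (i₁,…,i_n)`. -/
def Sw (T : System I) : List I → ℝ × ℝ → ℝ × ℝ
  | [], a => a
  | i :: w, a => S T i (Sw T w a)

/-- The top-left entry `f_{w,x}(a)` of the (lower triangular) Jacobian `D_a S_w`,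
via the chain rule. -/
def fxw (T : System I) : List I → ℝ × ℝ → ℝ
  | [], _ => 1
  | i :: w, a => T.fx i (Sw T w a).1 * fxw T w a

/-- The bottom-right entry `g_{w,y}(a)` of the Jacobian `D_a S_w`. -/
def gyw (T : System I) : List I → ℝ × ℝ → ℝ
  | [], _ => 1
  | i :: w, a => T.gy i (Sw T w a) * gyw T w a

/-- The off-diagonal entry `g_{w,x}(a)` of the Jacobian `D_a S_w`. -/
def gxw (T : System I) : List I → ℝ × ℝ → ℝ
  | [], _ => 0
  | i :: w, a => T.gx i (Sw T w a) * fxw T w a + T.gy i (Sw T w a) * gxw T w a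

/-- The Jacobian matrix `D_a S_w`. -/
def Dmat (T : System I) (w : List I) (a : ℝ × ℝ) : Matrix (Fin 2) (Fin 2) ℝ :=
  !![fxw T w a, 0; gxw T w a, gyw T w a]

/-- The larger singular value `α₁(D_a S_w)`. -/
def alpha1 (T : System I) (w : List I) (a : ℝ × ℝ) : ℝ := sv1 (Dmat T w a)

/-- The smaller singular value `α₂(D_a S_w)`. -/
def alpha2 (T : System I) (w : List I) (a : ℝ × ℝ) : ℝ := sv2 (Dmat T w a)

/-- The restriction `i|n` of an infinite sequence to its first `n` symbols. -/
def word (ii : ℕ → I) (n : ℕ) : List I := List.ofFn (fun k : Fin n => ii k.1)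

/-- The iterated left shift `σⁿ`. -/
def shiftn (ii : ℕ → I) (n : ℕ) : ℕ → I := fun k => ii (k + n)

/-- The left shift `σ` on `Σ = I^ℕ`. -/
def shift (ii : ℕ → I) : ℕ → I := fun k => ii (k + 1)

/-- The cylinder set `[w] ⊆ Σ` of a finite word `w`. -/
def cyl (w : List I) : Set (ℕ → I) := {jj | ∀ k : Fin w.length, jj k.1 = w.get k}

/-- `F` is the attractor of the IFS: the (unique) nonempty compact subset of the unit
square with `F = ⋃ i, S i '' F`. -/
def IsAttractor (T : System I) (F : Set (ℝ × ℝ)) : Prop :=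
  F.Nonempty ∧ IsCompact F ∧ F ⊆ sq ∧ F = ⋃ i, S T i '' F

/-- The strong separation condition: the sets `S i '' F` are pairwise disjoint. -/
def SSC (T : System I) (F : Set (ℝ × ℝ)) : Prop :=
  ∀ i j : I, i ≠ j → Disjoint (S T i '' F) (S T j '' F)

/-- `Pi` is the canonical coding map `Π : Σ → [0,1]²`:
`Π(i)` is the unique point of `⋂ₙ S_{i|n}([0,1]²)`. -/
def IsCoding (T : System I) (Pi : (ℕ → I) → ℝ × ℝ) : Prop :=
  ∀ ii : ℕ → I, ∀ n : ℕ, Pi ii ∈ Sw T (word ii n) '' sq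

/-- `m` is quasi-Bernoulli with constant `L`:
`L⁻¹ m[w] m[v] ≤ m[wv] ≤ L m[w] m[v]` for all finite words `w, v`. -/
def QuasiBernoulli [MeasurableSpace I] (m : Measure (ℕ → I)) (L : ℝ) : Prop :=
  0 < L ∧ ∀ w v : List I,
    L⁻¹ * (m (cyl w)).toReal * (m (cyl v)).toReal ≤ (m (cyl (w ++ v))).toReal ∧
    (m (cyl (w ++ v))).toReal ≤ L * (m (cyl w)).toReal * (m (cyl v)).toReal

/-- The interval `Q₁(x,r) = [x - r/2, x + r/2]`. -/
def Q1 (x r : ℝ) : Set ℝ := Set.Icc (x - r / 2) (x + r / 2)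

/-- The square `Q₂(a,r) = (a₁ - r/2, a₁ + r/2) × (a₂ - r/2, a₂ + r/2)`. -/
def Q2 (a : ℝ × ℝ) (r : ℝ) : Set (ℝ × ℝ) :=
  Set.Ioo (a.1 - r / 2) (a.1 + r / 2) ×ˢ Set.Ioo (a.2 - r / 2) (a.2 + r / 2)

/-- The approximate square `B_n(a,r)`: points `b ∈ S_w([0,1]²)` with `|b₁ - a₁| ≤ r/2`. -/
def Bn (T : System I) (w : List I) (a : ℝ × ℝ) (r : ℝ) : Set (ℝ × ℝ) :=
  {b ∈ Sw T w '' sq | |b.1 - a.1| ≤ r / 2}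

/-- The closed Euclidean ball in `ℝ²`. -/
def ballE (x : ℝ × ℝ) (r : ℝ) : Set (ℝ × ℝ) := {y | dE x y ≤ r}

/-- A measure on `ℝ` is exact dimensional with dimension `s` if for a.e. `x`,
`log ν(B(x,r)) / log r → s` as `r → 0⁺`. -/
def ExactDim1 (ν : Measure ℝ) (s : ℝ) : Prop :=
  ∀ᵐ x ∂ν, Tendsto (fun r => Real.log (ν (Metric.closedBall x r)).toReal / Real.log r)
    (nhdsWithin 0 (Set.Ioi 0)) (nhds s)

/-- A measure on `ℝ²` is exact dimensional with dimension `s` (w.r.t. Euclidean balls). -/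
def ExactDim2 (ν : Measure (ℝ × ℝ)) (s : ℝ) : Prop :=
  ∀ᵐ x ∂ν, Tendsto (fun r => Real.log (ν (ballE x r)).toReal / Real.log r)
    (nhdsWithin 0 (Set.Ioi 0)) (nhds s)

/-- `η = sup_{i ∈ I, a, b ∈ [0,1]²} |g_{i,y}(a)| / |f_{i,x}(b)|`. -/
def eta (T : System I) : ℝ :=
  sSup {x : ℝ | ∃ i : I, ∃ a ∈ sq, ∃ b ∈ sq, x = |T.gy i a| / |T.fx i b.1|}

end FFL

namespace FFL

variable {I : Type} [Fintype I]

theorem S_mem_sq (T : System I) (i : I) {a : ℝ × ℝ} (ha : a ∈ sq) : S T i a ∈ sq :=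
  T.mapsTo i ha

theorem Sw_mem_sq (T : System I) (w : List I) {a : ℝ × ℝ} (ha : a ∈ sq) : Sw T w a ∈ sq := by
  induction w with
  | nil => exact ha
  | cons i w ih => exact S_mem_sq T i ih

theorem dE_le_two {a b : ℝ × ℝ} (ha : a ∈ sq) (hb : b ∈ sq) : dE a b ≤ 2 := by
  obtain ⟨⟨h1, h2⟩, h3, h4⟩ := ha
  obtain ⟨⟨h5, h6⟩, h7, h8⟩ := hb
  exact Real.sqrt_le_iff.2 ⟨by norm_num, by nlinarith⟩

theorem bddAbove_abs_gy (T : System I) (i : I) : BddAbove ((fun a => |T.gy i a|) '' sq) := by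
  obtain ⟨α, hα, H, hH, h⟩ := T.holder
  have h0 : ((0 : ℝ), (0 : ℝ)) ∈ sq := ⟨by simp, by simp⟩
  refine ⟨|T.gy i (0, 0)| + H * 2 ^ α, ?_⟩
  rintro _ ⟨a, ha, rfl⟩
  have h1 := (h i).2.2 a ha _ h0
  have h2 : dE a (0, 0) ^ α ≤ 2 ^ α :=
    Real.rpow_le_rpow (Real.sqrt_nonneg _) (dE_le_two ha h0) hα.le
  have h3 := abs_sub_abs_le_abs_sub (T.gy i a) (T.gy i (0, 0))
  have h4 := mul_le_mul_of_nonneg_left h2 hH.le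
  dsimp only
  linarith

/-- Mean value lower bound for the first coordinate map. -/
theorem sInf_abs_fx_mul_le (T : System I) (i : I) {x y : ℝ} (hx : x ∈ Icc (0 : ℝ) 1)
    (hy : y ∈ Icc (0 : ℝ) 1) :
    sInf ((fun x => |T.fx i x|) '' Icc (0 : ℝ) 1) * |x - y| ≤ |T.f i x - T.f i y| := by
  wlog hxy : y < x generalizing x y
  · rcases (not_lt.1 hxy).eq_or_lt with rfl | h
    · simp
    · rw [abs_sub_comm x, abs_sub_comm (T.f i x)]
      exact this hy hx h
  have hsub : Icc y x ⊆ Icc (0 : ℝ) 1 := Icc_subset_Icc hy.1 hx.2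
  obtain ⟨c, hc, hslope⟩ := exists_hasDerivAt_eq_slope (T.f i) (T.fx i) hxy
    (fun z hz => ((T.hasDeriv_f i z (hsub hz)).continuousWithinAt).mono hsub)
    (fun z hz => (T.hasDeriv_f i z (hsub (Ioo_subset_Icc_self hz))).hasDerivAt
      (Icc_mem_nhds (hy.1.trans_lt hz.1) (hz.2.trans_le hx.2)))
  have hinf : sInf ((fun x => |T.fx i x|) '' Icc (0 : ℝ) 1) ≤ |T.fx i c| :=
    csInf_le ⟨0, by rintro _ ⟨z, -, rfl⟩; exact abs_nonneg _⟩
      ⟨c, hsub (Ioo_subset_Icc_self hc), rfl⟩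
  have heq : T.f i x - T.f i y = T.fx i c * (x - y) := by
    rw [hslope, div_mul_cancel₀ _ (sub_ne_zero.2 hxy.ne')]
  rw [heq, abs_mul]
  exact mul_le_mul_of_nonneg_right hinf (abs_nonneg _)

/-- Mean value upper bound for vertical increments of the second coordinate map. -/
theorem abs_g_vertical_sub_le (T : System I) (i : I) {x y z : ℝ} (hx : x ∈ Icc (0 : ℝ) 1)
    (hy : y ∈ Icc (0 : ℝ) 1) (hz : z ∈ Icc (0 : ℝ) 1) :
    |T.g i (x, y) - T.g i (x, z)| ≤ sSup ((fun a => |T.gy i a|) '' sq) * |y - z| := by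
  have hderiv : ∀ t ∈ Icc (0 : ℝ) 1,
      HasDerivWithinAt (fun t => T.g i (x, t)) (T.gy i (x, t)) (Icc (0 : ℝ) 1) t := by
    intro t ht
    have h := (T.hasDeriv_g i (x, t) ⟨hx, ht⟩).comp_hasDerivWithinAt t
      ((hasDerivWithinAt_const t (Icc (0 : ℝ) 1) x).prodMk
        (hasDerivWithinAt_id t (Icc (0 : ℝ) 1))) (fun s hs => ⟨hx, hs⟩)
    simpa [Function.comp_def] using h
  exact (convex_Icc (0 : ℝ) 1).norm_image_sub_le_of_norm_hasDerivWithin_le hderiv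
    (fun t ht => le_csSup (bddAbove_abs_gy T i) ⟨(x, t), ⟨hx, ht⟩, rfl⟩) hz hy

theorem abs_g_horizontal_sub_le (T : System I) (i : I) {x y z : ℝ} (hx : x ∈ Icc (0 : ℝ) 1)
    (hy : y ∈ Icc (0 : ℝ) 1) (hz : z ∈ Icc (0 : ℝ) 1) :
    |T.g i (x, z) - T.g i (y, z)| ≤ |x - y| := by
  obtain ⟨c, -, hc, h⟩ := T.contracting
  have h1 := (h i).2.1 (x, z) ⟨hx, hz⟩ (y, z) ⟨hy, hz⟩
  have h2 : dE (x, z) (y, z) = |x - y| := by simp [dE, Real.sqrt_sq_eq_abs]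
  rw [h2] at h1
  nlinarith [abs_nonneg (x - y)]

/-- The cone `|Δ₂| ≤ C |Δ₁|` is invariant under `S i` once its slope is large enough. -/
theorem S_cone_invariant (T : System I) (i : I) {C : ℝ}
    (hC : 1 + sSup ((fun a => |T.gy i a|) '' sq) * C ≤
      C * sInf ((fun x => |T.fx i x|) '' Icc (0 : ℝ) 1)) (hC₀ : 0 ≤ C)
    {p q : ℝ × ℝ} (hp : p ∈ sq) (hq : q ∈ sq) (hpq : |p.2 - q.2| ≤ C * |p.1 - q.1|) :
    |(S T i p).2 - (S T i q).2| ≤ C * |(S T i p).1 - (S T i q).1| := by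
  set s := sSup ((fun a => |T.gy i a|) '' sq)
  have hs₀ : 0 ≤ s := Real.sSup_nonneg (by rintro _ ⟨a, -, rfl⟩; exact abs_nonneg _)
  calc |T.g i (p.1, p.2) - T.g i (q.1, q.2)|
      ≤ |T.g i (p.1, p.2) - T.g i (q.1, p.2)| + |T.g i (q.1, p.2) - T.g i (q.1, q.2)| :=
        abs_sub_le _ _ _
    _ ≤ |p.1 - q.1| + s * |p.2 - q.2| :=
        add_le_add (abs_g_horizontal_sub_le T i hp.1 hq.1 hp.2)
          (abs_g_vertical_sub_le T i hq.1 hp.2 hq.2)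
    _ ≤ |p.1 - q.1| + s * (C * |p.1 - q.1|) := by gcongr
    _ = (1 + s * C) * |p.1 - q.1| := by ring
    _ ≤ C * sInf ((fun x => |T.fx i x|) '' Icc (0 : ℝ) 1) * |p.1 - q.1| := by gcongr
    _ ≤ C * |T.f i p.1 - T.f i q.1| := by
        rw [mul_assoc]
        exact mul_le_mul_of_nonneg_left (sInf_abs_fx_mul_le T i hp.1 hq.1) hC₀

theorem exists_cone_slope (T : System I) : ∃ C > (0 : ℝ), ∀ i,
    1 + sSup ((fun a => |T.gy i a|) '' sq) * C ≤
      C * sInf ((fun x => |T.fx i x|) '' Icc (0 : ℝ) 1) := by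
  obtain ⟨d, -, hdom⟩ := T.domination
  set δ : I → ℝ := fun i => sInf ((fun x => |T.fx i x|) '' Icc (0 : ℝ) 1) -
    sSup ((fun a => |T.gy i a|) '' sq)
  have hδ₀ : ∀ i, 0 < δ i := fun i => sub_pos.2 (hdom i).2
  have hnn : ∀ i ∈ Finset.univ, 0 ≤ (δ i)⁻¹ := fun i _ => (inv_pos.2 (hδ₀ i)).le
  refine ⟨∑ i, (δ i)⁻¹ + 1, by linarith [Finset.sum_nonneg hnn], fun i => ?_⟩
  have h1 : (δ i)⁻¹ ≤ ∑ i, (δ i)⁻¹ + 1 := by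
    linarith [Finset.single_le_sum hnn (Finset.mem_univ i)]
  have h2 : 1 ≤ (∑ i, (δ i)⁻¹ + 1) * δ i := (inv_le_iff_one_le_mul₀ (hδ₀ i)).1 h1
  have h3 : δ i = sInf ((fun x => |T.fx i x|) '' Icc (0 : ℝ) 1) -
    sSup ((fun a => |T.gy i a|) '' sq) := rfl
  rw [h3, mul_sub] at h2
  linarith

end FFL

open FFL

/-- horizontal increments of `g_w` are dominated by those of `f_w`. -/
theorem stmt11 {I : Type} [Fintype I] (T : System I) :
    ∃ C > (0:ℝ), ∀ (w : List I), ∀ a₁ ∈ Set.Icc (0:ℝ) 1, ∀ b₁ ∈ Set.Icc (0:ℝ) 1,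
      ∀ b₂ ∈ Set.Icc (0:ℝ) 1, a₁ ≠ b₁ →
        |(Sw T w (b₁, b₂)).2 - (Sw T w (a₁, b₂)).2| ≤
          C * |(Sw T w (b₁, b₂)).1 - (Sw T w (a₁, b₂)).1| := by
  obtain ⟨C, hC₀, hC⟩ := exists_cone_slope T
  refine ⟨C, hC₀, fun w a₁ ha₁ b₁ hb₁ b₂ hb₂ _ => ?_⟩
  induction w with
  | nil => simpa [Sw] using mul_nonneg hC₀.le (abs_nonneg (b₁ - a₁))
  | cons i w ih =>
    exact S_cone_invariant T i (hC i) hC₀.le (Sw_mem_sq T w ⟨hb₁, hb₂⟩)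
      (Sw_mem_sq T w ⟨ha₁, hb₂⟩) ih
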